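/- Let G be a digraph on n vertices, x a perfect fractional matching of G with x_e ≤ b/n for all edges e and some b ≥ 1, T an oriented tree on m+1 vertices, and R = (R_0,...,R_m) a random tree in G according to T and x. Then P[R is self-avoiding] ≥ 1 - m²·b/n. -/

import Mathlib

open Finset

lemma rt_aux {V : Type*} [Fintype V] [DecidableEq V] (c : ℝ) (hc : 0 ≤ c) (v₀ : V) (m : ℕ) :
    ∀ (y : Fin (m + 1) → V → V → ℝ) (_ : ∀ j v w, 0 ≤ y j v w)
    (_ : ∀ j v, ∑ w, y j v w = 1) (_ : ∀ j v w, y j v w ≤ c)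
    (p : Fin (m + 1) → Fin (m + 1)) (_ : ∀ j, j ≠ 0 → p j < j),
    1 - (m : ℝ) * (m + 1) / 2 * c ≤
      ∑ f : Fin (m + 1) → V, (if Function.Injective f ∧ f 0 = v₀ then
        ∏ j, (if j ≠ 0 then y j (f (p j)) (f j) else 1) else 0) ∧
      ∑ f : Fin (m + 1) → V, (if Function.Injective f ∧ f 0 = v₀ then
        ∏ j, (if j ≠ 0 then y j (f (p j)) (f j) else 1) else 0) ≤ 1 := by
  induction m with
  | zero =>
    intro y _ _ _ p _
    have : ∑ f : Fin (0 + 1) → V, (if Function.Injective f ∧ f 0 = v₀ then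
        ∏ j, (if j ≠ 0 then y j (f (p j)) (f j) else 1) else 0) = 1 := by
      rw [Finset.sum_eq_single (fun _ => v₀)]
      · simp [Function.injective_of_subsingleton]
      · intro f _ hf
        rw [if_neg]
        rintro ⟨_, h⟩
        apply hf
        funext i
        have hi : i = 0 := Fin.ext (by have := i.isLt; simp)
        rw [hi, h]
      · simp
    rw [this]; simp
  | succ m ih =>
    intro y hy0 hy1 hyc p hp
    have hlast : (Fin.last (m+1)) ≠ 0 := Fin.last_pos.ne'
    let p' : Fin (m+1) → Fin (m+1) := fun j => if h : j ≠ 0 then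
      ⟨p j.castSucc, by
        have := hp j.castSucc (by simpa using h)
        have h2 := j.isLt
        rw [Fin.lt_def, Fin.val_castSucc] at this
        omega⟩ else 0
    have hp'c : ∀ j, j ≠ 0 → (p' j).castSucc = p j.castSucc := by
      intro j hj
      ext
      simp [p', hj]
    have hp' : ∀ j, j ≠ 0 → p' j < j := by
      intro j hj
      rw [← Fin.castSucc_lt_castSucc_iff, hp'c j hj]
      exact hp _ (by simpa using hj)
    obtain ⟨q, hq⟩ : ∃ q : Fin (m+1), q.castSucc = p (Fin.last (m+1)) :=
      ⟨(p (Fin.last (m+1))).castPred (hp _ hlast).ne, by simp⟩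
    obtain ⟨h1, h2⟩ := ih (fun j => y j.castSucc) (fun j => hy0 _) (fun j => hy1 _)
      (fun j => hyc _) p' hp'
    set F : (Fin (m+1) → V) → ℝ := fun f => (if Function.Injective f ∧ f 0 = v₀ then
        ∏ j, (if j ≠ 0 then y j.castSucc (f (p' j)) (f j) else 1) else 0) with hF
    have hF0 : ∀ f, 0 ≤ F f := by
      intro f
      simp only [hF]
      split_ifs
      · refine Finset.prod_nonneg fun j _ => ?_
        split_ifs
        · exact hy0 _ _ _
        · exact zero_le_one
      · exact le_rfl
    have key : ∑ f : Fin (m + 1 + 1) → V, (if Function.Injective f ∧ f 0 = v₀ then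
        ∏ j, (if j ≠ 0 then y j (f (p j)) (f j) else 1) else 0) =
        ∑ g : Fin (m+1) → V, F g * ∑ w, if w ∈ Set.range g then 0 else
          y (Fin.last (m+1)) (g q) w := by
      rw [← Equiv.sum_comp (Fin.snocEquiv (fun _ => V)), Fintype.sum_prod_type_right]
      refine Finset.sum_congr rfl fun g _ => ?_
      rw [Finset.mul_sum]
      refine Finset.sum_congr rfl fun w _ => ?_
      have e0 : (Fin.snoc g w : Fin (m+1+1) → V) 0 = g 0 := by
        rw [← Fin.castSucc_zero, Fin.snoc_castSucc (α := fun _ => V)]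
      have e1 : (Function.Injective (Fin.snoc g w : Fin (m+1+1) → V)) ↔
          Function.Injective g ∧ w ∉ Set.range g := Fin.snoc_injective_iff
      have e2 : ∏ j, (if j ≠ 0 then y j ((Fin.snoc g w : Fin (m+1+1) → V) (p j))
            ((Fin.snoc g w : Fin (m+1+1) → V) j) else 1) =
          (∏ j, (if j ≠ 0 then y j.castSucc (g (p' j)) (g j) else 1)) *
            y (Fin.last (m+1)) (g q) w := by
        rw [Fin.prod_univ_castSucc, if_pos hlast, ← hq, Fin.snoc_castSucc (α := fun _ => V),
          Fin.snoc_last (α := fun _ => V)]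
        congr 1
        refine Finset.prod_congr rfl fun j _ => ?_
        by_cases hj : j = 0
        · simp [hj]
        · rw [if_pos (by simpa using hj), if_pos hj, ← hp'c j hj,
            Fin.snoc_castSucc (α := fun _ => V), Fin.snoc_castSucc (α := fun _ => V)]
      change (if Function.Injective (Fin.snoc g w : Fin (m+1+1) → V) ∧
        (Fin.snoc g w : Fin (m+1+1) → V) 0 = v₀ then _ else _) = _
      simp only [e0, e1, hF]
      by_cases hw : w ∈ Set.range g
      · simp [hw]
      · by_cases hg : Function.Injective g ∧ g 0 = v₀
        · rw [if_pos ⟨⟨hg.1, hw⟩, hg.2⟩, if_pos hg, if_neg hw]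
          exact e2
        · rw [if_neg (fun h => hg ⟨h.1.1, h.2⟩), if_neg hg, zero_mul]
    have up : ∀ g : Fin (m+1) → V, (∑ w, if w ∈ Set.range g then 0 else
          y (Fin.last (m+1)) (g q) w) ≤ 1 := by
      intro g
      rw [← hy1 (Fin.last (m+1)) (g q)]
      refine Finset.sum_le_sum fun w _ => ?_
      split_ifs
      · exact hy0 _ _ _
      · exact le_rfl
    have lo : ∀ g : Fin (m+1) → V, 1 - (m+1) * c ≤ (∑ w, if w ∈ Set.range g then 0 else
          y (Fin.last (m+1)) (g q) w) := by
      intro g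
      have hs := hy1 (Fin.last (m+1)) (g q)
      rw [sub_le_iff_le_add]
      have h3 : ∑ w, (if w ∈ Set.range g then c else 0) ≤ (m+1) * c := by
        rw [← Finset.sum_filter, Finset.sum_const, nsmul_eq_mul]
        refine mul_le_mul_of_nonneg_right ?_ hc
        have : (Finset.univ.filter (fun w => w ∈ Set.range g)) = Finset.univ.image g := by
          ext w; simp
        rw [this]
        have := Finset.card_image_le (s := Finset.univ) (f := g)
        rw [Finset.card_univ, Fintype.card_fin] at this
        exact_mod_cast this
      refine le_trans ?_ (add_le_add_right h3 _)
      rw [← hs, ← Finset.sum_add_distrib]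
      refine Finset.sum_le_sum fun w _ => ?_
      split_ifs
      · simpa using hyc _ _ _
      · simp
    rw [key]
    constructor
    · have : (∑ g, F g) * (1 - (m+1) * c) ≤ ∑ g : Fin (m+1) → V, F g * ∑ w,
          if w ∈ Set.range g then 0 else y (Fin.last (m+1)) (g q) w := by
        rw [Finset.sum_mul]
        exact Finset.sum_le_sum fun g _ => mul_le_mul_of_nonneg_left (lo g) (hF0 g)
      refine le_trans ?_ this
      have h4 : 0 ≤ ((m:ℝ)+1) * c := by positivity
      push_cast
      nlinarith [mul_le_mul_of_nonneg_right h2 h4]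
    · refine le_trans (Finset.sum_le_sum fun g _ =>
        mul_le_of_le_one_right (hF0 g) (up g)) h2

/-- A random tree in a digraph on `n` vertices according to an oriented tree `T` on `m+1`
vertices and a perfect fractional matching `x` with `x_e ≤ b/n` is self-avoiding with
probability at least `1 - m² b / n`.

The digraph and matching are encoded by `x : V → V → ℝ` (weight `0` off edges), with all
row and column sums equal to `1`.  The oriented tree is encoded by a parent function `p`
(`p j < j` for `j ≠ 0`) together with an orientation `o : Fin (m+1) → Bool` (`o j = true`
iff the tree edge is oriented from the parent of `r_j` towards `r_j`).  A realisation of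
the random tree is a map `f : Fin (m+1) → V` with root `f 0 = v₀`, occurring with
probability `∏_{j ≠ 0} x (f (p j)) (f j)` (resp. with the arguments swapped, according to
the orientation).  The sum of these probabilities over injective (self-avoiding)
realisations is at least `1 - m² b / n`. -/
theorem random_tree_self_avoiding {V : Type*} [Fintype V] [DecidableEq V]
    (n m : ℕ) (hcard : Fintype.card V = n)
    (b : ℝ) (hb : 1 ≤ b)
    (x : V → V → ℝ) (hx0 : ∀ v w, 0 ≤ x v w)
    (hrow : ∀ v, ∑ w, x v w = 1) (hcol : ∀ v, ∑ w, x w v = 1)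
    (hxb : ∀ v w, x v w ≤ b / n)
    (p : Fin (m + 1) → Fin (m + 1)) (hp : ∀ j, j ≠ 0 → p j < j)
    (o : Fin (m + 1) → Bool) (v₀ : V) :
    1 - (m : ℝ) ^ 2 * b / n ≤
      ∑ f ∈ Finset.univ.filter
          (fun f : Fin (m + 1) → V => Function.Injective f ∧ f 0 = v₀),
        ∏ j ∈ Finset.univ.filter (fun j : Fin (m + 1) => j ≠ 0),
          (if o j then x (f (p j)) (f j) else x (f j) (f (p j))) := by
  have hc : (0:ℝ) ≤ b / n := by positivity
  have h := (rt_aux (b / n) hc v₀ m (fun j v w => if o j then x v w else x w v)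
    (fun j v w => by split_ifs <;> exact hx0 _ _)
    (fun j v => by
      cases o j
      · simpa using hcol v
      · simpa using hrow v)
    (fun j v w => by split_ifs <;> exact hxb _ _) p hp).1
  simp only [Finset.sum_filter, Finset.prod_filter]
  refine le_trans ?_ h
  have h5 : (m:ℝ) * (m+1) / 2 ≤ (m:ℝ)^2 := by
    rcases Nat.eq_zero_or_pos m with h0 | h0
    · simp [h0]
    · have : (1:ℝ) ≤ m := by exact_mod_cast h0
      nlinarith
  have := mul_le_mul_of_nonneg_right h5 hc
  rw [mul_div_assoc]
  linarith
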